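/- Let f : A → A be a covering map of degree d with |d| > 1, let F : Ã → Ã be a lift of f, and let X ⊆ A be a nonempty compact set that is totally invariant, i.e., f⁻¹(X) = X. For z ∈ π⁻¹(X) set H(z) = lim_{n→∞} (Fⁿ(z))₁ / dⁿ (this limit exists and defines a continuous function with H(z+1) = H(z)+1), and let h : X → S¹ be the induced map determined by h(π(z)) = exp(2πi·H(z)). Then: (a) if x, y ∈ X with x ≠ y and f(x) = f(y), then h(x) ≠ h(y); (b) m_d⁻¹(h(X)) = h(X), where m_d(z) = z^d on S¹; consequently h(X) = S¹. -/

import Mathlib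

open Set Filter Topology

noncomputable section

/-- The open annulus `A = S¹ × (0,1)`. -/
abbrev Ann : Type := Circle × (Set.Ioo (0:ℝ) 1)

/-- The universal cover `Ã = ℝ × (0,1)`. -/
abbrev AnnTil : Type := ℝ × (Set.Ioo (0:ℝ) 1)

/-- The covering projection `π(x,y) = (exp(2πix), y)`. -/
def pr : AnnTil → Ann := fun z => (Circle.exp (2 * Real.pi * z.1), z.2)

/-- Translation by an integer in the first coordinate: `z + k`. -/
def tr (z : AnnTil) (k : ℤ) : AnnTil := (z.1 + k, z.2)

/-- `F` is a lift of `f`. -/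
def IsLift (f : Ann → Ann) (F : AnnTil → AnnTil) : Prop :=
  Continuous F ∧ pr ∘ F = f ∘ pr

/-- `f` has degree `d`: some lift satisfies `F(z+1) = F(z) + d`. -/
def HasDegree (f : Ann → Ann) (d : ℤ) : Prop :=
  ∃ F : AnnTil → AnnTil, IsLift f F ∧ ∀ z, F (tr z 1) = tr (F z) d

/-- A subset of the annulus is essential if it is not contained in any
connected, simply connected open subset. -/
def IsEssential (K : Set Ann) : Prop :=
  ¬ ∃ U : Set Ann, IsOpen U ∧ IsConnected U ∧ SimplyConnectedSpace U ∧ K ⊆ U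

/-- Nielsen equivalence of fixed points `p`, `q` of `g`: there is a path `γ`
from `p` to `q` homotopic (rel endpoints) to `g ∘ γ`. -/
def NielsenEquiv (g : Ann → Ann) (p q : Ann) : Prop :=
  ∃ (hg : Continuous g) (hp : g p = p) (hq : g q = q) (γ : Path p q),
    γ.Homotopic ((γ.map hg).cast hp.symm hq.symm)

/-- `g` has exactly `N` Nielsen classes of fixed points. -/
def HasExactlyNielsenClasses (g : Ann → Ann) (N : ℕ) : Prop :=
  ∃ S : Finset Ann, S.card = N ∧ (∀ p ∈ S, g p = p) ∧
    (∀ p ∈ S, ∀ q ∈ S, p ≠ q → ¬ NielsenEquiv g p q) ∧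
    (∀ p, g p = p → ∃ q ∈ S, NielsenEquiv g p q)

/-- `Fill K`: the union of `K` with the connected components of its
complement whose closure is compact. -/
def Fill (K : Set Ann) : Set Ann :=
  K ∪ {x | x ∈ Kᶜ ∧ IsCompact (closure (connectedComponentIn Kᶜ x))}

theorem cov_e : IsCoveringMap (fun t : ℝ => Circle.exp (2 * Real.pi * t)) :=
  Circle.isCoveringMap_exp.comp_homeomorph
    (Homeomorph.mulLeft₀ (2 * Real.pi) (by positivity))

theorem e_eq_iff {s t : ℝ} : Circle.exp (2 * Real.pi * s) = Circle.exp (2 * Real.pi * t) ↔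
    ∃ k : ℤ, s = t + k := by
  rw [Circle.exp_eq_exp]
  refine exists_congr fun k => ?_
  have hp : (2 * Real.pi) ≠ 0 := by positivity
  constructor
  · intro h
    apply mul_left_cancel₀ hp
    linarith
  · rintro rfl
    ring

theorem pr_surj : Function.Surjective pr := by
  rintro ⟨c, y⟩
  obtain ⟨t, rfl⟩ := Circle.exp_surjective c
  refine ⟨(t / (2 * Real.pi), y), ?_⟩
  have hp : (2 * Real.pi) ≠ 0 := by positivity
  simp only [pr]
  rw [mul_div_cancel₀ _ hp]

theorem pr_cont : Continuous pr := by
  unfold pr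
  fun_prop

theorem pr_eq_iff {z w : AnnTil} : pr z = pr w ↔ ∃ k : ℤ, z = tr w k := by
  simp only [pr, tr, Prod.ext_iff, e_eq_iff]
  constructor
  · rintro ⟨⟨k, hk⟩, h2⟩
    exact ⟨k, hk, h2⟩
  · rintro ⟨k, hk, h2⟩
    exact ⟨⟨k, hk⟩, h2⟩

theorem pr_tr (z : AnnTil) (k : ℤ) : pr (tr z k) = pr z := pr_eq_iff.2 ⟨k, rfl⟩

theorem contr_til : ContractibleSpace AnnTil := by
  haveI : ContractibleSpace (Set.Ioo (0:ℝ) 1) :=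
    (convex_Ioo (0:ℝ) 1).contractibleSpace ⟨1/2, by norm_num, by norm_num⟩
  infer_instance

theorem lift_inj {f : Ann → Ann} {F : AnnTil → AnnTil} (hcov : IsCoveringMap f)
    (hF : IsLift f F) : Function.Injective F := by
  haveI := contr_til
  intro z w hzw
  obtain ⟨hFc, hFl⟩ := hF
  let γ : Path z w := PathConnectedSpace.somePath z w
  have hom : ((γ.map hFc).cast rfl hzw).Homotopic (Path.refl (F z)) :=
    SimplyConnectedSpace.paths_homotopic _ _
  have hom1 : ContinuousMap.HomotopicRel
      ((⟨f, hcov.continuous⟩ : C(Ann, Ann)).comp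
        ((⟨pr, pr_cont⟩ : C(AnnTil, Ann)).comp γ.toContinuousMap))
      ((⟨f, hcov.continuous⟩ : C(Ann, Ann)).comp (ContinuousMap.const _ (pr z))) {0, 1} := by
    have h2 := ContinuousMap.HomotopicRel.comp_continuousMap hom (⟨pr, pr_cont⟩ : C(AnnTil, Ann))
    convert h2 using 1
    · ext1 t
      exact (congrFun hFl (γ t)).symm
    · ext1 t
      exact (congrFun hFl z).symm
  have hom2 := (hcov.homotopicRel_iff_comp (S := {0, 1})
    (f₀ := (⟨pr, pr_cont⟩ : C(AnnTil, Ann)).comp γ.toContinuousMap)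
    (f₁ := ContinuousMap.const _ (pr z)) ⟨0, by simp, by simp⟩).2 hom1
  have hom3 := ContinuousMap.HomotopicRel.comp_continuousMap hom2
    (⟨Prod.fst, continuous_fst⟩ : C(Ann, Circle))
  have hom4 := (cov_e.homotopicRel_iff_comp (S := {0, 1})
    (f₀ := (⟨Prod.fst, continuous_fst⟩ : C(AnnTil, ℝ)).comp γ.toContinuousMap)
    (f₁ := ContinuousMap.const _ z.1) ⟨0, by simp, by simp⟩).2 hom3
  obtain ⟨K2⟩ := hom2
  obtain ⟨K4⟩ := hom4
  have e2 : pr w = pr z := by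
    have := K2.fst_eq_snd (x := 1) (by simp)
    simpa using this
  have e4 : w.1 = z.1 := by
    have := K4.fst_eq_snd (x := 1) (by simp)
    simpa using this
  exact Prod.ext e4.symm (congrArg Prod.snd e2).symm

theorem lift_surj {f : Ann → Ann} {F : AnnTil → AnnTil} (hcov : IsCoveringMap f)
    (hF : IsLift f F) : Function.Surjective F := by
  haveI := contr_til
  intro w
  obtain ⟨hFc, hFl⟩ := hF
  obtain ⟨z⟩ : Nonempty AnnTil := inferInstance
  let β : Path (F z) w := PathConnectedSpace.somePath _ _
  obtain ⟨δ, hδ, hδ0⟩ := hcov.exists_path_lifts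
    ((⟨pr, pr_cont⟩ : C(AnnTil, Ann)).comp β.toContinuousMap) (pr z)
    (by simpa using congrFun hFl z)
  obtain ⟨ρ, hρ, hρ0⟩ := cov_e.exists_path_lifts
    ((⟨Prod.fst, continuous_fst⟩ : C(Ann, Circle)).comp δ) z.1
    (by simp [hδ0, pr])
  let γ : unitInterval → AnnTil := fun t => (ρ t, (δ t).2)
  have hγc : Continuous γ := by fun_prop
  have hprγ : ∀ t, pr (γ t) = δ t := fun t => Prod.ext (congrFun hρ t) rfl
  have hγ0 : γ 0 = z := Prod.ext hρ0 (by simp [γ, hδ0, pr])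
  have key : ∀ t, pr (F (γ t)) = pr (β t) := fun t => by
    rw [← Function.comp_apply (f := pr) (g := F), hFl, Function.comp_apply, hprγ]
    exact congrFun hδ t
  have h1 : (fun t => (F (γ t)).1) = fun t => (β t).1 :=
    cov_e.eq_of_comp_eq (by fun_prop) (by fun_prop)
      (funext fun t => congrArg Prod.fst (key t)) 0 (by simp [hγ0])
  refine ⟨γ 1, ?_⟩
  have e1 := congrFun h1 1
  have e2 := congrArg Prod.snd (key 1)
  simp only [pr, β.target] at e1 e2
  exact Prod.ext e1 e2

/-- For a totally invariant compact set `X`, the semiconjugacy `h` is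
injective on fibers of `f`, and `h(X)` is totally invariant under `m_d`;
consequently `h(X) = S¹`. -/
theorem stmt_18 (f : Ann → Ann) (d : ℤ) (hcov : IsCoveringMap f)
    (hdeg : HasDegree f d) (hd : 1 < |d|)
    (F : AnnTil → AnnTil) (hF : IsLift f F)
    (hFdeg : ∀ z : AnnTil, F (tr z 1) = tr (F z) d)
    (X : Set Ann) (hXne : X.Nonempty) (hXc : IsCompact X)
    (hXtot : f ⁻¹' X = X)
    (H : AnnTil → ℝ) (hHcont : ContinuousOn H (pr ⁻¹' X))
    (hHlim : ∀ z ∈ pr ⁻¹' X, Filter.Tendsto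
      (fun n : ℕ => (F^[n] z).1 / (d : ℝ) ^ n) Filter.atTop (nhds (H z)))
    (hHper : ∀ z ∈ pr ⁻¹' X, H (tr z 1) = H z + 1)
    (h : Ann → Circle)
    (hh : ∀ z ∈ pr ⁻¹' X, h (pr z) = Circle.exp (2 * Real.pi * H z)) :
    (∀ x ∈ X, ∀ y ∈ X, x ≠ y → f x = f y → h x ≠ h y) ∧
    (fun z : Circle => z ^ d) ⁻¹' (h '' X) = h '' X ∧
    h '' X = Set.univ := by
  have hdR : (1:ℝ) < |(d:ℝ)| := by exact_mod_cast hd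
  have hd0 : (d:ℝ) ≠ 0 := by
    intro h0
    rw [h0] at hdR
    norm_num at hdR
  have hFX : ∀ z, F z ∈ pr ⁻¹' X ↔ z ∈ pr ⁻¹' X := by
    intro z
    have h1 : pr (F z) = f (pr z) := congrFun hF.2 z
    rw [mem_preimage, mem_preimage, h1, ← mem_preimage (f := f), hXtot]
  have htrX : ∀ z k, tr z k ∈ pr ⁻¹' X ↔ z ∈ pr ⁻¹' X := by
    intro z k
    rw [mem_preimage, mem_preimage, pr_tr]
  have hHF : ∀ z ∈ pr ⁻¹' X, H (F z) = d * H z := by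
    intro z hz
    have t1 := hHlim (F z) ((hFX z).2 hz)
    have t2 := ((tendsto_add_atTop_iff_nat 1).2 (hHlim z hz)).const_mul (d:ℝ)
    refine tendsto_nhds_unique t1 (t2.congr fun n => ?_)
    rw [Function.iterate_succ_apply, pow_succ]
    field_simp
  have hHtr : ∀ z ∈ pr ⁻¹' X, ∀ k : ℤ, H (tr z k) = H z + k := by
    intro z hz k
    induction k using Int.induction_on with
    | zero => simp [tr]
    | succ n ih =>
      have := hHper (tr z n) ((htrX _ _).2 hz)
      rw [ih] at this
      have e : tr (tr z n) 1 = tr z (n + 1) := by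
        simp [tr, add_assoc]
      rw [e] at this
      rw [this]
      push_cast
      ring
    | pred n ih =>
      have := hHper (tr z (-n - 1)) ((htrX _ _).2 hz)
      have e : tr (tr z (-n - 1)) 1 = tr z (-n) := by
        simp [tr, add_assoc]
      rw [e, ih] at this
      push_cast at this ⊢
      linarith
  have hinj := lift_inj hcov hF
  have hsurj := lift_surj hcov hF
  -- preimages under multiplication by `d`
  have hpre : ∀ z ∈ pr ⁻¹' X, ∀ k : ℤ, ∃ z' ∈ pr ⁻¹' X, H z' = (H z + k) / d := by
    intro z hz k
    obtain ⟨z', hz'⟩ := hsurj (tr z k)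
    have hm : z' ∈ pr ⁻¹' X := (hFX z').1 (by rw [hz']; exact (htrX _ _).2 hz)
    refine ⟨z', hm, ?_⟩
    have h1 := hHF z' hm
    rw [hz', hHtr z hz] at h1
    rw [h1]
    field_simp
  have hpow : ∀ t : ℝ, Circle.exp (2 * Real.pi * t) ^ d = Circle.exp (2 * Real.pi * (d * t)) := by
    intro t
    rw [← Circle.exp_intCast_mul]
    congr 1
    ring
  have hexp : ∀ w : Circle, ∃ t : ℝ, w = Circle.exp (2 * Real.pi * t) := by
    intro w
    obtain ⟨t, rfl⟩ := Circle.exp_surjective w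
    refine ⟨t / (2 * Real.pi), ?_⟩
    have hp : (2 * Real.pi) ≠ 0 := by positivity
    rw [mul_div_cancel₀ _ hp]
  refine ⟨?_, ?_, ?_⟩
  · intro x hx y hy hxy hfxy hhxy
    obtain ⟨z, rfl⟩ := pr_surj x
    obtain ⟨w, rfl⟩ := pr_surj y
    rw [hh z hx, hh w hy, e_eq_iff] at hhxy
    obtain ⟨k, hk⟩ := hhxy
    have hw' : tr w k ∈ pr ⁻¹' X := (htrX _ _).2 hy
    rw [← hHtr w hy] at hk
    have h1 : pr (F z) = pr (F (tr w k)) := by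
      have a1 : pr (F z) = f (pr z) := congrFun hF.2 z
      have a2 : pr (F (tr w k)) = f (pr (tr w k)) := congrFun hF.2 _
      rw [a1, a2, pr_tr, hfxy]
    obtain ⟨m, hm⟩ := pr_eq_iff.1 h1
    have h2 : H (F z) = H (F (tr w k)) + m := by
      rw [hm, hHtr _ ((hFX _).2 hw')]
    rw [hHF z hx, hHF _ hw', hk] at h2
    have hm0 : m = 0 := by
      have : (m:ℝ) = 0 := by linarith
      exact_mod_cast this
    have h3 : F z = F (tr w k) := by
      rw [hm, hm0]
      simp [tr]
    apply hxy
    rw [hinj h3, pr_tr]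
  · ext w
    constructor
    · rintro ⟨x, hx, hxw⟩
      obtain ⟨z, rfl⟩ := pr_surj x
      obtain ⟨t, rfl⟩ := hexp w
      simp only [hpow] at hxw
      rw [hh z hx, eq_comm, e_eq_iff] at hxw
      obtain ⟨k, hk⟩ := hxw
      obtain ⟨z', hz', hH'⟩ := hpre z hx k
      refine ⟨pr z', hz', ?_⟩
      rw [hh z' hz', hH', ← hk]
      congr 2
      field_simp
    · rintro ⟨x, hx, rfl⟩
      obtain ⟨z, rfl⟩ := pr_surj x
      refine ⟨pr (F z), (hFX z).2 hx, ?_⟩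
      simp only
      rw [hh _ ((hFX z).2 hx), hh z hx, hpow, hHF z hx]
  · -- closedness
    have hcl : IsClosed (h '' X) := by
      have hK : IsCompact ((Icc (0:ℝ) 1 ×ˢ (Prod.snd '' X)) ∩ pr ⁻¹' X) :=
        (isCompact_Icc.prod (hXc.image continuous_snd)).inter_right
          (hXc.isClosed.preimage pr_cont)
      have hcont : ContinuousOn (fun z => Circle.exp (2 * Real.pi * H z)) (pr ⁻¹' X) :=
        Circle.exp.continuous.comp_continuousOn (continuousOn_const.mul hHcont)
      have hI := hK.image_of_continuousOn (hcont.mono inter_subset_right)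
      convert hI.isClosed using 1
      ext w
      constructor
      · rintro ⟨x, hx, rfl⟩
        obtain ⟨z, rfl⟩ := pr_surj x
        have hx' : tr z (-⌊z.1⌋) ∈ pr ⁻¹' X := (htrX _ _).2 hx
        refine ⟨tr z (-⌊z.1⌋), ⟨⟨⟨?_, ?_⟩, ⟨pr z, hx, rfl⟩⟩, hx'⟩, ?_⟩
        · simp only [tr]
          push_cast
          linarith [Int.floor_le z.1]
        · simp only [tr]
          push_cast
          linarith [Int.lt_floor_add_one z.1]
        · simp only
          rw [← hh _ hx', pr_tr]
      · rintro ⟨z, ⟨-, hz⟩, rfl⟩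
        exact ⟨pr z, hz, hh z hz⟩
    obtain ⟨x₀, hx₀⟩ := hXne
    obtain ⟨z₀, rfl⟩ := pr_surj x₀
    have hiter : ∀ n : ℕ, ∀ k : ℤ, ∃ z ∈ pr ⁻¹' X, H z = (H z₀ + k) / (d:ℝ) ^ n := by
      intro n
      induction n with
      | zero =>
        intro k
        exact ⟨tr z₀ k, (htrX _ _).2 hx₀, by rw [hHtr _ hx₀]; simp⟩
      | succ n ih =>
        intro k
        obtain ⟨z, hz, hHz⟩ := ih k
        obtain ⟨z', hz', hH'⟩ := hpre z hz 0
        refine ⟨z', hz', ?_⟩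
        rw [hH', hHz, pow_succ]
        push_cast
        rw [add_zero, div_div]
    refine eq_univ_of_forall fun w => ?_
    obtain ⟨s, rfl⟩ := hexp w
    choose g hg hHg using fun n : ℕ => hiter n ⌊s * (d:ℝ) ^ n - H z₀⌋
    have hlim : Tendsto (fun n => H (g n)) atTop (𝓝 s) := by
      have hb : Tendsto (fun n : ℕ => (|(d:ℝ)|⁻¹) ^ n) atTop (𝓝 0) :=
        tendsto_pow_atTop_nhds_zero_of_lt_one (by positivity) (inv_lt_one_of_one_lt₀ hdR)
      rw [tendsto_iff_dist_tendsto_zero]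
      refine squeeze_zero (fun _ => dist_nonneg) (fun n => ?_) hb
      have hdn : (d:ℝ) ^ n ≠ 0 := pow_ne_zero _ hd0
      have e1 : H (g n) - s =
          (⌊s * (d:ℝ) ^ n - H z₀⌋ - (s * (d:ℝ) ^ n - H z₀)) / (d:ℝ) ^ n := by
        rw [hHg]
        field_simp
        ring
      rw [Real.dist_eq, e1, abs_div, abs_pow, inv_pow, div_eq_mul_inv]
      refine mul_le_of_le_one_left (by positivity) ?_
      rw [abs_le]
      constructor
      · linarith [Int.lt_floor_add_one (s * (d:ℝ) ^ n - H z₀)]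
      · linarith [Int.floor_le (s * (d:ℝ) ^ n - H z₀)]
    have hlim2 : Tendsto (fun n => Circle.exp (2 * Real.pi * H (g n))) atTop
        (𝓝 (Circle.exp (2 * Real.pi * s))) :=
      (Circle.exp.continuous.tendsto _).comp (hlim.const_mul _)
    exact hcl.mem_of_tendsto hlim2
      (Eventually.of_forall fun n => ⟨pr (g n), hg n, hh _ (hg n)⟩)
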